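/- Let X be a finite set, let u^1 and u^2 be two ultrametrics on X, and let θ ∈ [0,1]. Define A^{12}(x,x';θ) = θ·u^1(x,x') + (1−θ)·u^2(x,x') and u^{12}(x,x';θ) = min over chains C(x,x') of max_i A^{12}(x_i, x_{i+1}; θ). Then u^{12}(·,·;θ) is a valid ultrametric on X: it is symmetric, satisfies u^{12}(x,x';θ) = 0 iff x = x', and satisfies the strong triangle inequality u^{12}(x,x';θ) ≤ max(u^{12}(x,x'';θ), u^{12}(x'',x';θ)) for all x, x', x''. -/

import Mathlib

noncomputable section

/-- Cost of a chain (a finite ordered list of nodes): the maximum dissimilarity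
encountered over consecutive pairs (0 for chains with fewer than two nodes). -/
def chainCost {X : Type*} (A : X → X → ℝ) : List X → ℝ
  | [] => 0
  | [_] => 0
  | a :: b :: rest => max (A a b) (chainCost A (b :: rest))

/-- The set of costs of chains from `x` to `x'`. -/
def chainCosts {X : Type*} (A : X → X → ℝ) (x x' : X) : Set ℝ :=
  { c | ∃ l : List X, l.head? = some x ∧ l.getLast? = some x' ∧ chainCost A l = c }

/-- Directed minimum chain cost ũ*(x,x'). -/
def minChainCost {X : Type*} (A : X → X → ℝ) (x x' : X) : ℝ :=
  sInf (chainCosts A x x')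

/-- The reciprocal ultrametric u^R. -/
def uR {X : Type*} (A : X → X → ℝ) (x x' : X) : ℝ :=
  minChainCost (fun a b => max (A a b) (A b a)) x x'

/-- The nonreciprocal ultrametric u^NR. -/
def uNR {X : Type*} (A : X → X → ℝ) (x x' : X) : ℝ :=
  max (minChainCost A x x') (minChainCost A x' x)

/-- The set of costs of chains from `x` to `x'` having at most `t` nodes. -/
def boundedChainCosts {X : Type*} (A : X → X → ℝ) (t : ℕ) (x x' : X) : Set ℝ :=
  { c | ∃ l : List X, l.head? = some x ∧ l.getLast? = some x' ∧ l.length ≤ t ∧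
      chainCost A l = c }

/-- A^{SR(t)}(x,x'): minimum cost over chains from `x` to `x'` with at most `t` nodes. -/
def ASR {X : Type*} (A : X → X → ℝ) (t : ℕ) (x x' : X) : ℝ :=
  sInf (boundedChainCosts A t x x')

/-- The semi-reciprocal ultrametric u^{SR(t)}. -/
def uSR {X : Type*} (A : X → X → ℝ) (t : ℕ) (x x' : X) : ℝ :=
  minChainCost (fun a b => max (ASR A t a b) (ASR A t b a)) x x'

/-- The convex combination ultrametric u^{12}(·,·;θ): single linkage applied to
the convex combination θ·u¹ + (1−θ)·u² of two ultrametrics. -/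
def uConvex {X : Type*} (u1 u2 : X → X → ℝ) (θ : ℝ) (x x' : X) : ℝ :=
  minChainCost (fun a b => θ * u1 a b + (1 - θ) * u2 a b) x x'

theorem chainCost_nonneg {X : Type*} (A : X → X → ℝ) : ∀ l : List X, 0 ≤ chainCost A l
  | [] => le_rfl
  | [_] => le_rfl
  | _ :: b :: rest => le_max_of_le_right (chainCost_nonneg A (b :: rest))

theorem chainCost_lt_iff {X : Type*} (A : X → X → ℝ) {r : ℝ} (hr : 0 < r) :
    ∀ l : List X, chainCost A l < r ↔ l.IsChain (fun a b => A a b < r)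
  | [] => by simp [chainCost, hr]
  | [_] => by simp [chainCost, hr]
  | a :: b :: rest => by
    simp [chainCost, chainCost_lt_iff A hr (b :: rest)]

theorem chainCosts_nonempty {X : Type*} (A : X → X → ℝ) (x x' : X) :
    (chainCosts A x x').Nonempty :=
  ⟨_, [x, x'], by simp, by simp, rfl⟩

theorem bddBelow_chainCosts {X : Type*} (A : X → X → ℝ) (x x' : X) :
    BddBelow (chainCosts A x x') :=
  ⟨0, by rintro _ ⟨l, -, -, rfl⟩; exact chainCost_nonneg A l⟩

theorem minChainCost_nonneg {X : Type*} (A : X → X → ℝ) (x x' : X) :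
    0 ≤ minChainCost A x x' :=
  Real.sInf_nonneg (by rintro _ ⟨l, -, -, rfl⟩; exact chainCost_nonneg A l)

/-- The minimum chain cost is below a positive threshold exactly when the endpoints are connected
by steps whose dissimilarity is below that threshold. -/
theorem minChainCost_lt_iff {X : Type*} (A : X → X → ℝ) (x x' : X) {r : ℝ} (hr : 0 < r) :
    minChainCost A x x' < r ↔ Relation.ReflTransGen (fun a b => A a b < r) x x' := by
  rw [minChainCost, csInf_lt_iff (bddBelow_chainCosts A x x') (chainCosts_nonempty A x x')]
  constructor
  · rintro ⟨_, ⟨l, hx, hx', rfl⟩, hl⟩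
    have hne : l ≠ [] := by rintro rfl; simp at hx
    rw [List.head?_eq_some_head hne, Option.some_inj] at hx
    rw [List.getLast?_eq_some_getLast hne, Option.some_inj] at hx'
    rw [← hx, ← hx']
    exact List.relationReflTransGen_of_exists_isChain l ((chainCost_lt_iff A hr l).1 hl) hne
  · intro h
    obtain ⟨l, hl, hlast⟩ := List.exists_isChain_cons_of_relationReflTransGen h
    refine ⟨_, ⟨x :: l, rfl, ?_, rfl⟩, (chainCost_lt_iff A hr _).2 hl⟩
    rw [List.getLast?_eq_some_getLast (List.cons_ne_nil _ _), hlast]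

theorem minChainCost_self {X : Type*} (A : X → X → ℝ) (x : X) : minChainCost A x x = 0 :=
  le_antisymm
    (le_of_forall_gt fun _ hr => (minChainCost_lt_iff A x x hr).2 .refl)
    (minChainCost_nonneg A x x)

theorem minChainCost_le_max {X : Type*} (A : X → X → ℝ) (x x' x'' : X) :
    minChainCost A x x' ≤ max (minChainCost A x x'') (minChainCost A x'' x') := by
  refine le_of_forall_gt fun r h => ?_
  obtain ⟨h₁, h₂⟩ := max_lt_iff.1 h
  have hr : 0 < r := (minChainCost_nonneg A x x'').trans_lt h₁
  rw [minChainCost_lt_iff A _ _ hr] at h₁ h₂ ⊢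
  exact h₁.trans h₂

theorem minChainCost_comm {X : Type*} {A : X → X → ℝ} (hA : ∀ a b, A a b = A b a) (x x' : X) :
    minChainCost A x x' = minChainCost A x' x := by
  have key : ∀ y y', minChainCost A y y' ≤ minChainCost A y' y := fun y y' => by
    refine le_of_forall_gt fun r h => ?_
    have hr : 0 < r := (minChainCost_nonneg A y' y).trans_lt h
    rw [minChainCost_lt_iff A _ _ hr] at h ⊢
    rw [← Relation.reflTransGen_swap]
    exact Relation.ReflTransGen.mono (fun a b hab => (hA b a).trans_lt hab) _ _ h
  exact (key x x').antisymm (key x' x)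

theorem exists_pos_forall_ne_le {X : Type*} [Finite X] {A : X → X → ℝ}
    (hA : ∀ a b, a ≠ b → 0 < A a b) : ∃ δ > 0, ∀ a b, a ≠ b → δ ≤ A a b := by
  cases isEmpty_or_nonempty {p : X × X // p.1 ≠ p.2} with
  | inl h => exact ⟨1, one_pos, fun a b hab => (h.false ⟨(a, b), hab⟩).elim⟩
  | inr h =>
    obtain ⟨p, hp⟩ := Finite.exists_min fun p : {p : X × X // p.1 ≠ p.2} => A p.1.1 p.1.2
    exact ⟨_, hA _ _ p.2, fun a b hab => hp ⟨(a, b), hab⟩⟩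

theorem minChainCost_eq_zero_iff {X : Type*} [Finite X] {A : X → X → ℝ}
    (hA : ∀ a b, a ≠ b → 0 < A a b) (x x' : X) : minChainCost A x x' = 0 ↔ x = x' := by
  refine ⟨fun h => ?_, fun h => h ▸ minChainCost_self A x⟩
  obtain ⟨δ, hδ, hle⟩ := exists_pos_forall_ne_le hA
  have hconn := (minChainCost_lt_iff A x x' hδ).1 (h.trans_lt hδ)
  have hstep : ∀ a b, A a b < δ → a = b := fun a b hab =>
    by_contra fun hne => (hle a b hne).not_gt hab
  clear h
  induction hconn with
  | refl => rfl
  | tail _ hbc ih => exact ih.trans (hstep _ _ hbc)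

/-- given two ultrametrics u¹, u² on a finite set X and θ ∈ [0,1],
the convex combination u^{12}(·,·;θ) is a valid ultrametric on X. -/
theorem convex_combination_is_ultrametric {X : Type*} [Fintype X]
    (u1 u2 : X → X → ℝ)
    (h1nonneg : ∀ x x' : X, 0 ≤ u1 x x')
    (h1symm : ∀ x x' : X, u1 x x' = u1 x' x)
    (h1id : ∀ x x' : X, u1 x x' = 0 ↔ x = x')
    (h1tri : ∀ x x' x'' : X, u1 x x' ≤ max (u1 x x'') (u1 x'' x'))
    (h2nonneg : ∀ x x' : X, 0 ≤ u2 x x')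
    (h2symm : ∀ x x' : X, u2 x x' = u2 x' x)
    (h2id : ∀ x x' : X, u2 x x' = 0 ↔ x = x')
    (h2tri : ∀ x x' x'' : X, u2 x x' ≤ max (u2 x x'') (u2 x'' x'))
    (θ : ℝ) (hθ0 : 0 ≤ θ) (hθ1 : θ ≤ 1) :
    (∀ x x' : X, uConvex u1 u2 θ x x' = uConvex u1 u2 θ x' x) ∧
    (∀ x x' : X, uConvex u1 u2 θ x x' = 0 ↔ x = x') ∧
    (∀ x x' x'' : X,
      uConvex u1 u2 θ x x' ≤ max (uConvex u1 u2 θ x x'') (uConvex u1 u2 θ x'' x')) := by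
  refine ⟨fun x x' => minChainCost_comm (fun a b => by rw [h1symm a b, h2symm a b]) x x',
    fun x x' => minChainCost_eq_zero_iff (fun a b hab => ?_) x x',
    fun x x' x'' => minChainCost_le_max _ x x' x''⟩
  have h₁ : 0 < u1 a b := (h1nonneg a b).lt_of_ne' (mt (h1id a b).1 hab)
  have h₂ : 0 < u2 a b := (h2nonneg a b).lt_of_ne' (mt (h2id a b).1 hab)
  rcases hθ0.eq_or_lt with rfl | hθ
  · simpa using h₂
  · have := mul_nonneg (sub_nonneg.2 hθ1) h₂.le
    positivity
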